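/- arXiv:2006.00224 — 3 statements merged into one kernel-verified Lean document; each statement's English description precedes it below -/
import Mathlib

section
/- Let K be a field of characteristic zero, r ≥ 2, s ≥ 2, and let L be the free nilpotent Lie algebra of rank r and step s over K with generators X_1, …, X_r. Let η_0, η_1, …, η_r be any r+1 elements of C_{s−2}(L) (the (s−2)-th term of the lower central series of L). For p ∈ L* let M(p) be the (r+1)×(r+1) matrix whose row indexed by 0 has entries p(η_j) (j = 0,…,r) and whose row indexed by i ∈ {1,…,r} has entries p(⁅X_i, η_j⁆). Then p ↦ det M(p) is infinitesimally invariant under the coadjoint representation: for every p ∈ L* and every v ∈ L, setting q(w) = p(⁅v,w⁆), the sum over i = 0,…,r of the determinant of the matrix obtained from M(p) by replacing its i-th row by the row (q(η_j))_j when i = 0, respectively (q(⁅X_i,η_j⁆))_j when i ≥ 1, is equal to 0. (This sum is the directional derivative of det M at p along the coadjoint direction q, so every such bordered minor is a Casimir function.) -/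
/-- The free nilpotent Lie algebra of rank `r` and step `s` over `K`: the quotient of the
free Lie algebra `F` on `r` generators by the `s`-th term `C_s(F)` of its lower central
series (`C_0 = F`, `C_{k+1} = ⁅F, C_k⁆`). -/
abbrev FreeNilpotentLie (K : Type*) [Field K] (r s : ℕ) :=
  FreeLieAlgebra K (Fin r) ⧸
    LieModule.lowerCentralSeries K (FreeLieAlgebra K (Fin r)) (FreeLieAlgebra K (Fin r)) s

/-- The canonical generators `X_1, …, X_r` of the free nilpotent Lie algebra, i.e. the images
of the free generators. -/
noncomputable def FreeNilpotentLie.gen (K : Type*) [Field K] (r s : ℕ) (i : Fin r) :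
    FreeNilpotentLie K r s :=
  LieSubmodule.Quotient.mk' _ (FreeLieAlgebra.of K i)

/-- `G₁`: the `K`-span of the generators. -/
noncomputable def FreeNilpotentLie.G1 (K : Type*) [Field K] (r s : ℕ) :
    Submodule K (FreeNilpotentLie K r s) :=
  Submodule.span K (Set.range (FreeNilpotentLie.gen K r s))

theorem LieModule.lie_lie_mem_lowerCentralSeries {R L M : Type*} [CommRing R] [LieRing L]
    [LieAlgebra R L] [AddCommGroup M] [Module R M] [LieRingModule L M] [LieModule R L M]
    {k : ℕ} {m : M} (hm : m ∈ LieModule.lowerCentralSeries R L M k) (a b : L) :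
    ⁅a, ⁅b, m⁆⁆ ∈ LieModule.lowerCentralSeries R L M (k + 2) := by
  rw [LieModule.lowerCentralSeries_succ, LieModule.lowerCentralSeries_succ]
  exact LieSubmodule.lie_mem_lie (LieSubmodule.mem_top a)
    (LieSubmodule.lie_mem_lie (LieSubmodule.mem_top b) hm)

namespace FreeNilpotentLie

/-- A Lie subalgebra of the free nilpotent Lie algebra that contains the generators is
everything. -/
theorem lieSubalgebra_eq_top {K : Type*} [Field K] {r s : ℕ}
    (S : LieSubalgebra K (FreeNilpotentLie K r s)) (hS : ∀ i, gen K r s i ∈ S) : S = ⊤ := by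
  let π : FreeLieAlgebra K (Fin r) →ₗ⁅K⁆ FreeNilpotentLie K r s :=
    { (LieSubmodule.Quotient.mk' (LieModule.lowerCentralSeries K (FreeLieAlgebra K (Fin r))
        (FreeLieAlgebra K (Fin r)) s) : _ →ₗ[K] _) with
      map_lie' := fun {x y} => LieSubmodule.Quotient.mk_bracket _ x y }
  let f : FreeLieAlgebra K (Fin r) →ₗ⁅K⁆ S := FreeLieAlgebra.lift K fun i => ⟨gen K r s i, hS i⟩
  have hf : S.incl.comp f = π := by
    refine FreeLieAlgebra.hom_ext fun i => ?_
    rw [LieHom.comp_apply, FreeLieAlgebra.lift_of_apply]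
    rfl
  refine eq_top_iff.2 fun v _ => ?_
  obtain ⟨x, rfl⟩ := LieSubmodule.Quotient.surjective_mk' _ v
  have hx : ((f x : S) : FreeNilpotentLie K r s) = π x := LieHom.congr_fun hf x
  exact hx ▸ (f x).2

theorem lowerCentralSeries_eq_bot (K : Type*) [Field K] (r s : ℕ) :
    LieModule.lowerCentralSeries K (FreeNilpotentLie K r s) (FreeNilpotentLie K r s) s = ⊥ := by
  rw [← LieSubmodule.toSubmodule_inj, ← coe_lowerCentralSeries_ideal_quot_eq,
    ← LieModule.map_lowerCentralSeries_eq s (LieSubmodule.Quotient.surjective_mk' _),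
    (LieSubmodule.Quotient.map_mk'_eq_bot_le _ _).2 le_rfl]
  rfl

theorem lie_lie_eq_zero {K : Type*} [Field K] {r s : ℕ} (hs : 2 ≤ s)
    {y : FreeNilpotentLie K r s}
    (hy : y ∈ LieModule.lowerCentralSeries K (FreeNilpotentLie K r s)
      (FreeNilpotentLie K r s) (s - 2))
    (a b : FreeNilpotentLie K r s) : ⁅a, ⁅b, y⁆⁆ = 0 := by
  have h := LieModule.lie_lie_mem_lowerCentralSeries (R := K) hy a b
  rw [Nat.sub_add_cancel hs, lowerCentralSeries_eq_bot] at h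
  exact (LieSubmodule.mem_bot _).1 h

end FreeNilpotentLie

/-- Let `L` be the free nilpotent Lie algebra of rank `r ≥ 2` and step
`s ≥ 2` over a field of characteristic zero with generators `X_1, …, X_r`, and let
`η_0, …, η_r ∈ C_{s-2}(L)`.  For `p ∈ L*` let `M(p)` be the `(r+1) × (r+1)` matrix whose
row `0` has entries `p (η_j)` and whose row `i ∈ {1, …, r}` has entries `p ⁅X_i, η_j⁆`.
Then `p ↦ det M(p)` is infinitesimally invariant under the coadjoint representation:
for all `p` and `v`, with `q w = p ⁅v, w⁆`, the sum over `i` of the determinants of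
`M(p)` with its `i`-th row replaced by the corresponding `q`-row vanishes. -/
theorem bordered_minors_are_casimirs
    (K : Type*) [Field K] [CharZero K] (r s : ℕ) (hr : 2 ≤ r) (hs : 2 ≤ s)
    (η : Fin (r + 1) → FreeNilpotentLie K r s)
    (hη : ∀ j, η j ∈ LieModule.lowerCentralSeries K (FreeNilpotentLie K r s)
      (FreeNilpotentLie K r s) (s - 2))
    (p : Module.Dual K (FreeNilpotentLie K r s)) (v : FreeNilpotentLie K r s) :
    ∑ i : Fin (r + 1),
      (Matrix.updateRow
        (Matrix.of (Fin.cons (fun j => p (η j))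
          (fun i' j => p ⁅FreeNilpotentLie.gen K r s i', η j⁆)))
        i
        ((Fin.cons (fun j => p ⁅v, η j⁆)
          (fun i' j => p ⁅v, ⁅FreeNilpotentLie.gen K r s i', η j⁆⁆) :
            Fin (r + 1) → Fin (r + 1) → K) i)).det = 0 := by
  set M : Matrix (Fin (r + 1)) (Fin (r + 1)) K :=
    Matrix.of (Fin.cons (fun j => p (η j))
      (fun i' j => p ⁅FreeNilpotentLie.gen K r s i', η j⁆))
  have hlie (a b : FreeNilpotentLie K r s) (j) : ⁅a, ⁅b, η j⁆⁆ = 0 :=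
    FreeNilpotentLie.lie_lie_eq_zero hs (hη j) a b
  have hzero : (M.updateRow 0 fun _ => (0 : K)).det = 0 :=
    Matrix.det_eq_zero_of_row_eq_zero 0 (by simp)
  rw [Fin.sum_univ_succ, Finset.sum_eq_zero, add_zero, Fin.cons_zero]
  · let S : LieSubalgebra K (FreeNilpotentLie K r s) :=
      { carrier := {w | (M.updateRow 0 fun j => p ⁅w, η j⁆).det = 0}
        zero_mem' := by
          simpa only [Set.mem_ofPred_eq, zero_lie, map_zero] using hzero
        add_mem' := fun {a b} ha hb => by
          simp only [Set.mem_ofPred_eq, add_lie, map_add] at ha hb ⊢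
          exact (Matrix.det_updateRow_add M 0 _ _).trans (by rw [ha, hb, add_zero])
        smul_mem' := fun c a ha => by
          simp only [Set.mem_ofPred_eq, smul_lie, map_smul] at ha ⊢
          exact (Matrix.det_updateRow_smul M 0 c _).trans (by rw [ha, mul_zero])
        lie_mem' := fun {a b} _ _ => by
          simpa only [Set.mem_ofPred_eq, lie_lie, hlie, sub_zero, map_zero] using hzero }
    have hS : S = ⊤ := FreeNilpotentLie.lieSubalgebra_eq_top S fun i =>
      Matrix.det_updateRow_eq_zero (M := M) (Fin.succ_ne_zero i)
    exact (hS ▸ LieSubalgebra.mem_top v : v ∈ S)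
  · intro i _
    refine Matrix.det_eq_zero_of_row_eq_zero i.succ fun j => ?_
    rw [Matrix.updateRow_self, Fin.cons_succ, hlie, map_zero]
end

section
/- Let K be a field of characteristic zero, s ≥ 3, r ≥ 2, and assume r ≥ 3 or s ≥ 4 (equivalently, the (s−1)-st graded component of the free nilpotent Lie algebra has dimension at least r). Let L be the free nilpotent Lie algebra of rank r and step s over K with generators X_1, …, X_r. Then there exists p ∈ L* such that the linear map from C_{s−2}(L) to K^r sending η to the tuple (p(⁅X_1,η⁆), …, p(⁅X_r,η⁆)) is surjective. -/
lemma LieHom.apply_mem_lowerCentralSeries {R L L' : Type*} [CommRing R] [LieRing L]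
    [LieAlgebra R L] [LieRing L'] [LieAlgebra R L'] (f : L →ₗ⁅R⁆ L') (k : ℕ) {x : L}
    (hx : x ∈ LieModule.lowerCentralSeries R L L k) :
    f x ∈ LieModule.lowerCentralSeries R L' L' k :=
  LieIdeal.map_lowerCentralSeries_le k (LieIdeal.mem_map hx)

lemma LieModule.lie_mem_lowerCentralSeries_succ {R L : Type*} [CommRing R] [LieRing L]
    [LieAlgebra R L] (k : ℕ) (x : L) {y : L}
    (hy : y ∈ LieModule.lowerCentralSeries R L L k) :
    ⁅x, y⁆ ∈ LieModule.lowerCentralSeries R L L (k + 1) := by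
  rw [LieModule.lowerCentralSeries_succ]
  exact LieSubmodule.lie_mem_lie (LieSubmodule.mem_top x) hy

open MvPolynomial in
/-- The linear form `∑ i, v i * X i`. -/
noncomputable def linearFormOfVector (K : Type*) [Field K] (r : ℕ) :
    (Fin r → K) →ₗ[K] MvPolynomial (Fin r) K :=
  Fintype.linearCombination K (X : Fin r → MvPolynomial (Fin r) K)

/-- The semidirect product of the abelian Lie algebra `K ^ r` with the abelian Lie algebra
`K[X_1, …, X_r] ^ r`, on which the `i`-th basis vector of `K ^ r` acts as multiplication by
`X_i`. It receives the free metabelian Lie algebra of rank `r`. -/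
@[ext]
structure MagnusLie (K : Type*) [Field K] (r : ℕ) where
  /-- The component in `K ^ r`. -/
  vec : Fin r → K
  /-- The component in `K[X_1, …, X_r] ^ r`. -/
  poly : Fin r → MvPolynomial (Fin r) K

namespace MagnusLie

variable {K : Type*} [Field K] {r : ℕ}

/-- The underlying type is a product. -/
def equivProd (K : Type*) [Field K] (r : ℕ) :
    MagnusLie K r ≃ (Fin r → K) × (Fin r → MvPolynomial (Fin r) K) where
  toFun x := (x.vec, x.poly)
  invFun x := ⟨x.1, x.2⟩

noncomputable instance : AddCommGroup (MagnusLie K r) :=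
  (equivProd K r).addCommGroup

noncomputable instance : Module K (MagnusLie K r) :=
  (equivProd K r).module K

noncomputable instance : Bracket (MagnusLie K r) (MagnusLie K r) where
  bracket x y :=
    ⟨0, linearFormOfVector K r x.vec • y.poly - linearFormOfVector K r y.vec • x.poly⟩

@[simp] lemma add_vec (x y : MagnusLie K r) : (x + y).vec = x.vec + y.vec := rfl
@[simp] lemma add_poly (x y : MagnusLie K r) : (x + y).poly = x.poly + y.poly := rfl
@[simp] lemma zero_vec : (0 : MagnusLie K r).vec = 0 := rfl
@[simp] lemma zero_poly : (0 : MagnusLie K r).poly = 0 := rfl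
@[simp] lemma smul_vec (a : K) (x : MagnusLie K r) : (a • x).vec = a • x.vec := rfl
@[simp] lemma smul_poly (a : K) (x : MagnusLie K r) : (a • x).poly = a • x.poly := rfl
@[simp] lemma lie_vec (x y : MagnusLie K r) : ⁅x, y⁆.vec = 0 := rfl
@[simp] lemma lie_poly (x y : MagnusLie K r) :
    ⁅x, y⁆.poly =
      linearFormOfVector K r x.vec • y.poly - linearFormOfVector K r y.vec • x.poly := rfl

noncomputable instance : LieRing (MagnusLie K r) where
  add_lie x y z := by
    ext1
    · simp
    · simp only [lie_poly, add_vec, add_poly, map_add]; module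
  lie_add x y z := by
    ext1
    · simp
    · simp only [lie_poly, add_vec, add_poly, map_add]; module
  lie_self x := by ext1 <;> simp
  leibniz_lie x y z := by
    ext1
    · simp
    · simp only [lie_poly, lie_vec, add_poly, map_zero]; module

noncomputable instance : LieAlgebra K (MagnusLie K r) where
  lie_smul a x y := by
    ext1
    · simp
    · simp only [lie_poly, smul_vec, smul_poly, map_smul, smul_sub, smul_assoc]
      rw [smul_comm]

/-- The projection to the `j`-th polynomial coordinate. -/
noncomputable def polyCoord (j : Fin r) : MagnusLie K r →ₗ[K] MvPolynomial (Fin r) K where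
  toFun x := x.poly j
  map_add' _ _ := rfl
  map_smul' _ _ := rfl

@[simp] lemma polyCoord_apply (j : Fin r) (x : MagnusLie K r) : polyCoord j x = x.poly j := rfl

/-- The elements `(e_i, e_i)`. -/
noncomputable def gen (i : Fin r) : MagnusLie K r :=
  ⟨Pi.single i 1, Pi.single i 1⟩

@[simp] lemma linearFormOfVector_gen_vec (i : Fin r) :
    linearFormOfVector K r (gen i : MagnusLie K r).vec = MvPolynomial.X i := by
  simp [gen, linearFormOfVector]

lemma gen_poly (i : Fin r) : (gen i : MagnusLie K r).poly = Pi.single i 1 := rfl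

lemma linearFormOfVector_mem (v : Fin r → K) :
    linearFormOfVector K r v ∈ MvPolynomial.idealOfVars (Fin r) K := by
  rw [linearFormOfVector, Fintype.linearCombination_apply]
  exact Ideal.sum_mem _ fun i _ ↦
    Submodule.smul_of_tower_mem _ _ (Ideal.subset_span ⟨i, rfl⟩)

/-- The elements with zero vector component and polynomial components in the ideal `I`. -/
def idealSubmodule (I : Ideal (MvPolynomial (Fin r) K)) : Submodule K (MagnusLie K r) where
  carrier := {x | x.vec = 0 ∧ ∀ j, x.poly j ∈ I}
  add_mem' {x y} hx hy := ⟨by simp [hx.1, hy.1], fun j ↦ I.add_mem (hx.2 j) (hy.2 j)⟩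
  zero_mem' := by simp
  smul_mem' a x hx := ⟨by simp [hx.1], fun j ↦ Submodule.smul_of_tower_mem I a (hx.2 j)⟩

lemma lowerCentralSeries_le_idealSubmodule (k : ℕ) :
    (LieModule.lowerCentralSeries K (MagnusLie K r) (MagnusLie K r) (k + 1)).toSubmodule ≤
      idealSubmodule (MvPolynomial.idealOfVars (Fin r) K ^ (k + 1)) := by
  induction k with
  | zero =>
    rw [LieModule.lowerCentralSeries_succ, LieSubmodule.lieIdeal_oper_eq_linear_span',
      Submodule.span_le]
    rintro _ ⟨y, -, z, -, rfl⟩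
    refine ⟨rfl, fun j ↦ ?_⟩
    simp only [lie_poly, Pi.sub_apply, Pi.smul_apply, smul_eq_mul, zero_add, pow_one]
    exact Ideal.sub_mem _ (Ideal.mul_mem_right _ _ (linearFormOfVector_mem _))
      (Ideal.mul_mem_right _ _ (linearFormOfVector_mem _))
  | succ k ih =>
    rw [LieModule.lowerCentralSeries_succ, LieSubmodule.lieIdeal_oper_eq_linear_span',
      Submodule.span_le]
    rintro _ ⟨y, -, z, hz, rfl⟩
    obtain ⟨h₁, h₂⟩ := ih hz
    refine ⟨rfl, fun j ↦ ?_⟩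
    simp only [lie_poly, h₁, map_zero, zero_smul, sub_zero, Pi.smul_apply, smul_eq_mul]
    rw [pow_succ']
    exact Ideal.mul_mem_mul (linearFormOfVector_mem _) (h₂ j)

/-- The homomorphism from the free Lie algebra sending generators to `gen`. -/
noncomputable def ofFree (K : Type*) [Field K] (r : ℕ) :
    FreeLieAlgebra K (Fin r) →ₗ⁅K⁆ MagnusLie K r :=
  FreeLieAlgebra.lift K gen

@[simp] lemma ofFree_of (i : Fin r) : ofFree K r (FreeLieAlgebra.of K i) = gen i :=
  FreeLieAlgebra.lift_of_apply ..

lemma ofFree_lie_of_of_poly (a b : Fin r) :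
    (ofFree K r ⁅FreeLieAlgebra.of K a, FreeLieAlgebra.of K b⁆).poly =
      MvPolynomial.X a • Pi.single b 1 - MvPolynomial.X b • Pi.single a 1 := by
  simp [gen_poly]


lemma ofFree_lie_of (a : Fin r) {k : ℕ} {x : FreeLieAlgebra K (Fin r)}
    (hx : x ∈ LieModule.lowerCentralSeries K (FreeLieAlgebra K (Fin r))
      (FreeLieAlgebra K (Fin r)) (k + 1)) :
    ofFree K r ⁅FreeLieAlgebra.of K a, x⁆ =
      ⟨0, (MvPolynomial.X a : MvPolynomial (Fin r) K) • (ofFree K r x).poly⟩ := by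
  have := (lowerCentralSeries_le_idealSubmodule k ((ofFree K r).apply_mem_lowerCentralSeries _ hx)).1
  ext1
  · simp
  · simp [this]

lemma ad_pow_mem_and_ofFree_poly (a : Fin r) {k : ℕ} {x : FreeLieAlgebra K (Fin r)}
    (hx : x ∈ LieModule.lowerCentralSeries K (FreeLieAlgebra K (Fin r))
      (FreeLieAlgebra K (Fin r)) (k + 1)) (m : ℕ) :
    (LieAlgebra.ad K _ (FreeLieAlgebra.of K a) ^ m) x ∈
        LieModule.lowerCentralSeries K (FreeLieAlgebra K (Fin r))
          (FreeLieAlgebra K (Fin r)) (k + m + 1) ∧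
      (ofFree K r ((LieAlgebra.ad K _ (FreeLieAlgebra.of K a) ^ m) x)).poly =
        (MvPolynomial.X a ^ m : MvPolynomial (Fin r) K) • (ofFree K r x).poly := by
  induction m with
  | zero => simpa using hx
  | succ m ih =>
    rw [pow_succ', Module.End.mul_apply, LieAlgebra.ad_apply]
    refine ⟨LieModule.lie_mem_lowerCentralSeries_succ _ _ ih.1, ?_⟩
    rw [ofFree_lie_of a ih.1, ih.2, smul_smul, ← pow_succ']

end MagnusLie

open MvPolynomial in
/-- A family dual to multiplication by the variables, under a linear functional that vanishes in
polynomial degrees at least `s`, yields the functional on the free nilpotent Lie algebra. -/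
lemma exists_dual_of_magnus {K : Type*} [Field K] {r s : ℕ} (hs : 3 ≤ s)
    (f : Module.Dual K (MagnusLie K r))
    (hf : ∀ x : MagnusLie K r, (∀ j, x.poly j ∈ idealOfVars (Fin r) K ^ s) → f x = 0)
    (η : Fin r → FreeLieAlgebra K (Fin r))
    (hη : ∀ j, η j ∈ LieModule.lowerCentralSeries K (FreeLieAlgebra K (Fin r))
      (FreeLieAlgebra K (Fin r)) (s - 2))
    (hfη : ∀ i j, f ⟨0, (X i : MvPolynomial (Fin r) K) • (MagnusLie.ofFree K r (η j)).poly⟩ = if i = j then 1 else 0) :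
    ∃ p : Module.Dual K (FreeNilpotentLie K r s),
      ∀ c : Fin r → K,
        ∃ η ∈ LieModule.lowerCentralSeries K (FreeNilpotentLie K r s)
          (FreeNilpotentLie K r s) (s - 2),
          ∀ i : Fin r, p ⁅FreeNilpotentLie.gen K r s i, η⁆ = c i := by
  obtain ⟨k, rfl⟩ : ∃ k, s = k + 3 := ⟨s - 3, by omega⟩
  let I := LieModule.lowerCentralSeries K (FreeLieAlgebra K (Fin r))
    (FreeLieAlgebra K (Fin r)) (k + 3)
  let p : Module.Dual K (FreeNilpotentLie K r (k + 3)) :=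
    Submodule.liftQ I.toSubmodule (f ∘ₗ (MagnusLie.ofFree K r : _ →ₗ[K] _)) fun x hx ↦
      hf _ (MagnusLie.lowerCentralSeries_le_idealSubmodule (k + 2)
        ((MagnusLie.ofFree K r).apply_mem_lowerCentralSeries _ hx)).2
  have hp (x : FreeLieAlgebra K (Fin r)) :
      p (LieSubmodule.Quotient.mk' I x) = f (MagnusLie.ofFree K r x) := rfl
  refine ⟨p, fun c ↦ ⟨LieSubmodule.Quotient.mk' I (∑ j, c j • η j), ?_, fun i ↦ ?_⟩⟩
  · rw [← SetLike.mem_coe, ← LieSubmodule.coe_toSubmodule,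
      ← coe_lowerCentralSeries_ideal_quot_eq]
    exact LieModule.map_lowerCentralSeries_le _ (LieSubmodule.Quotient.mk' I)
      (LieSubmodule.mem_map_of_mem (sum_mem fun j _ ↦ SMulMemClass.smul_mem _ (hη j)))
  · have hlie (j : Fin r) := MagnusLie.ofFree_lie_of i (hη j)
    have : ⁅FreeNilpotentLie.gen K r (k + 3) i, LieSubmodule.Quotient.mk' I (∑ j, c j • η j)⁆ =
        LieSubmodule.Quotient.mk' I ⁅FreeLieAlgebra.of K i, ∑ j, c j • η j⁆ := rfl
    rw [this, hp]
    simp only [lie_sum, lie_smul, map_sum, map_smul, hlie, hfη]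
    simp

open MvPolynomial in
lemma MvPolynomial.coeff_add_X_mul_X_mul_monomial {σ R : Type*} [DecidableEq σ] [CommSemiring R]
    (i j : σ) (n d : σ →₀ ℕ) :
    coeff (d + n) (X i * X j * monomial n (1 : R)) =
      if Finsupp.single i 1 + Finsupp.single j 1 = d then 1 else 0 := by
  rw [X, X, monomial_mul, coeff_mul_monomial, coeff_monomial]
  simp

lemma Finsupp.single_one_add_single_one_eq_single_two_iff {σ : Type*} (i j l : σ) :
    Finsupp.single i 1 + Finsupp.single j 1 = Finsupp.single l 2 ↔ i = l ∧ j = l := by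
  classical
  constructor
  · intro h
    have hi := DFunLike.congr_fun h i
    have hj := DFunLike.congr_fun h j
    simp only [Finsupp.add_apply, Finsupp.single_apply] at hi hj
    grind
  · rintro ⟨rfl, rfl⟩
    rw [← Finsupp.single_add]

lemma Finsupp.single_one_add_single_one_eq_iff {σ : Type*} {a b : σ} (i j : σ) (hab : a ≠ b) :
    Finsupp.single i 1 + Finsupp.single j 1 = Finsupp.single a 1 + Finsupp.single b 1 ↔
      i = a ∧ j = b ∨ i = b ∧ j = a := by
  classical
  constructor
  · intro h
    have ha := DFunLike.congr_fun h a
    have hb := DFunLike.congr_fun h b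
    simp only [Finsupp.add_apply, Finsupp.single_apply] at ha hb
    grind
  · rintro (⟨rfl, rfl⟩ | ⟨rfl, rfl⟩)
    · rfl
    · rw [add_comm]

open MvPolynomial in
/-- The functional summing the coefficients of the monomials `X_l ^ 2 * X ^ n`. -/
noncomputable def squareCoeffSum (K : Type*) [Field K] {r : ℕ} (n : Fin r →₀ ℕ) :
    MvPolynomial (Fin r) K →ₗ[K] K :=
  ∑ l, lcoeff K (Finsupp.single l 2 + n)

open MvPolynomial in
lemma squareCoeffSum_X_mul_X_mul_monomial {K : Type*} [Field K] {r : ℕ} (n : Fin r →₀ ℕ)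
    (i j : Fin r) :
    squareCoeffSum K n (X i * X j * monomial n 1) = if i = j then 1 else 0 := by
  simp only [squareCoeffSum, LinearMap.sum_apply, lcoeff_apply,
    coeff_add_X_mul_X_mul_monomial, Finsupp.single_one_add_single_one_eq_single_two_iff]
  split_ifs with h
  · simp [h]
  · exact Finset.sum_eq_zero fun l _ ↦ if_neg (by grind)

open MvPolynomial in
lemma squareCoeffSum_eq_zero {K : Type*} [Field K] {r s : ℕ} {n : Fin r →₀ ℕ}
    (hn : n.degree + 2 < s) {q : MvPolynomial (Fin r) K}
    (hq : q ∈ idealOfVars (Fin r) K ^ s) : squareCoeffSum K n q = 0 := by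
  simp only [squareCoeffSum, LinearMap.sum_apply, lcoeff_apply]
  refine Finset.sum_eq_zero fun l _ ↦ (mem_pow_idealOfVars_iff' s q).1 hq _ ?_
  rw [map_add, Finsupp.degree_single]
  omega

open MvPolynomial in
lemma exists_dual_of_four_le {K : Type*} [Field K] {r s : ℕ} (hs : 4 ≤ s) {a b : Fin r}
    (hab : a ≠ b) :
    ∃ p : Module.Dual K (FreeNilpotentLie K r s),
      ∀ c : Fin r → K,
        ∃ η ∈ LieModule.lowerCentralSeries K (FreeNilpotentLie K r s)
          (FreeNilpotentLie K r s) (s - 2),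
          ∀ i : Fin r, p ⁅FreeNilpotentLie.gen K r s i, η⁆ = c i := by
  obtain ⟨m, rfl⟩ : ∃ m, s = m + 4 := ⟨s - 4, by omega⟩
  let n : Fin r →₀ ℕ := Finsupp.single b (m + 1)
  let F := FreeLieAlgebra K (Fin r)
  let x : Fin r → F := FreeLieAlgebra.of K
  have hx (i j : Fin r) : ⁅x i, x j⁆ ∈ LieModule.lowerCentralSeries K F F (0 + 1) :=
    LieModule.lie_mem_lowerCentralSeries_succ 0 _ (LieSubmodule.mem_top _)
  have h₁ (j : Fin r) := MagnusLie.ad_pow_mem_and_ofFree_poly b (hx j a) (m + 1)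
  have h₂ := MagnusLie.ad_pow_mem_and_ofFree_poly b
    (LieModule.lie_mem_lowerCentralSeries_succ _ (x a) (hx b a)) m
  refine exists_dual_of_magnus (by omega) (squareCoeffSum K n ∘ₗ MagnusLie.polyCoord a)
    (fun y hy ↦ squareCoeffSum_eq_zero (by simp [n]) (hy a))
    (fun j ↦ if j = a then (LieAlgebra.ad K F (x b) ^ m) ⁅x a, ⁅x b, x a⁆⁆
      else (LieAlgebra.ad K F (x b) ^ (m + 1)) ⁅x j, x a⁆) (fun j ↦ ?_) (fun i j ↦ ?_)
  · split_ifs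
    · convert h₂.1 using 2
      omega
    · convert (h₁ j).1 using 2
      omega
  · rw [← squareCoeffSum_X_mul_X_mul_monomial n i j, LinearMap.comp_apply,
      MagnusLie.polyCoord_apply]
    congr 1
    have hn : (monomial n 1 : MvPolynomial (Fin r) K) = X b ^ (m + 1) := by
      rw [X_pow_eq_monomial]
    rw [hn]
    split_ifs with hj
    · rw [h₂.2, MagnusLie.ofFree_lie_of _ (hx b a), MagnusLie.ofFree_lie_of_of_poly]
      simp [hj, hab]
      ring
    · rw [(h₁ j).2, MagnusLie.ofFree_lie_of_of_poly]
      simp [Ne.symm hj]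
      ring

open MvPolynomial in
lemma exists_dual_of_eq_three {K : Type*} [Field K] {r : ℕ} {a b c : Fin r} (hab : a ≠ b)
    (hac : a ≠ c) (hbc : b ≠ c) :
    ∃ p : Module.Dual K (FreeNilpotentLie K r 3),
      ∀ c : Fin r → K,
        ∃ η ∈ LieModule.lowerCentralSeries K (FreeNilpotentLie K r 3)
          (FreeNilpotentLie K r 3) (3 - 2),
          ∀ i : Fin r, p ⁅FreeNilpotentLie.gen K r 3 i, η⁆ = c i := by
  let F := FreeLieAlgebra K (Fin r)
  let x : Fin r → F := FreeLieAlgebra.of K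
  have hx (i j : Fin r) : ⁅x i, x j⁆ ∈ LieModule.lowerCentralSeries K F F (0 + 1) :=
    LieModule.lie_mem_lowerCentralSeries_succ 0 _ (LieSubmodule.mem_top _)
  have hxy (i j : Fin r) : (MagnusLie.ofFree K r ⁅x i, x j⁆).poly =
      (X i : MvPolynomial (Fin r) K) • Pi.single j 1 -
        (X j : MvPolynomial (Fin r) K) • Pi.single i 1 :=
    MagnusLie.ofFree_lie_of_of_poly i j
  let d : Fin r →₀ ℕ := Finsupp.single a 1 + Finsupp.single b 1
  let f : Module.Dual K (MagnusLie K r) :=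
    squareCoeffSum K 0 ∘ₗ MagnusLie.polyCoord a + lcoeff K d ∘ₗ MagnusLie.polyCoord c
  have hf (y : MagnusLie K r) : f y = squareCoeffSum K 0 (y.poly a) + coeff d (y.poly c) := rfl
  have hQ (i j : Fin r) : squareCoeffSum K 0 (X i * X j) = if i = j then 1 else 0 := by
    simpa using squareCoeffSum_X_mul_X_mul_monomial (K := K) 0 i j
  have hP (i j : Fin r) : coeff d (X i * X j : MvPolynomial (Fin r) K) =
      if i = a ∧ j = b ∨ i = b ∧ j = a then 1 else 0 := by
    rw [← if_congr (Finsupp.single_one_add_single_one_eq_iff i j hab) rfl rfl]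
    simpa using coeff_add_X_mul_X_mul_monomial (R := K) i j 0 d
  refine exists_dual_of_magnus le_rfl f (fun y hy ↦ ?_)
    (fun j ↦ if j = a then ⁅x b, x c⁆ else if j = c then ⁅x c, x a⁆ + ⁅x b, x a⁆ else ⁅x j, x a⁆)
    (fun j ↦ ?_) (fun i j ↦ ?_)
  · rw [hf, squareCoeffSum_eq_zero (by simp) (hy a),
      (mem_pow_idealOfVars_iff' 3 _).1 (hy c) _ (by simp [d]), add_zero]
  · split_ifs
    · exact hx _ _
    · exact add_mem (hx _ _) (hx _ _)
    · exact hx _ _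
  · rw [hf]
    by_cases hja : j = a
    · subst j
      simp [-LieHom.map_lie, hxy, hab, hab.symm, hac, hbc.symm, hP]
    by_cases hjc : j = c
    · subst j
      simp [-LieHom.map_lie, hja, hxy, hab, hac, hbc.symm, mul_add, hQ, hP]
    · simp [-LieHom.map_lie, hja, hjc, hxy, Ne.symm hja, Ne.symm hjc, hac.symm, hQ]

/-- Let `L` be the free nilpotent Lie algebra of rank `r ≥ 2` and step
`s ≥ 3` over a field of characteristic zero, with `r ≥ 3` or `s ≥ 4`.  Then there exists
`p ∈ L*` such that the linear map `C_{s-2}(L) → K^r`, `η ↦ (p ⁅X_1, η⁆, …, p ⁅X_r, η⁆)`,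
is surjective. -/
theorem exists_p_B1_surjective
    (K : Type*) [Field K] [CharZero K] (r s : ℕ) (hr : 2 ≤ r) (hs : 3 ≤ s)
    (h : 3 ≤ r ∨ 4 ≤ s) :
    ∃ p : Module.Dual K (FreeNilpotentLie K r s),
      ∀ c : Fin r → K,
        ∃ η ∈ LieModule.lowerCentralSeries K (FreeNilpotentLie K r s)
          (FreeNilpotentLie K r s) (s - 2),
          ∀ i : Fin r, p ⁅FreeNilpotentLie.gen K r s i, η⁆ = c i := by
  obtain hs | rfl := hs.lt_or_eq
  · exact exists_dual_of_four_le hs (a := ⟨0, by omega⟩) (b := ⟨1, by omega⟩) (by simp)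
  · exact exists_dual_of_eq_three (a := ⟨0, by omega⟩) (b := ⟨1, by omega⟩) (c := ⟨2, by omega⟩)
      (by simp) (by simp) (by simp)
end

section
/- Let K be a field of characteristic zero, r ≥ 2, and let L be the free nilpotent Lie algebra of rank r and step 3 over K, with G_1 the span of the generators. If u, v ∈ G_1 are linearly independent, then the intersection of the subspaces span{⁅u,x⁆ : x ∈ G_1} and span{⁅v,x⁆ : x ∈ G_1} of L is exactly the one-dimensional subspace spanned by ⁅u,v⁆. -/
/-- The two-step nilpotent Lie algebra `K ⊕ W ⊕ W` whose bracket is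
`⁅(s, w, z), (s', w', z')⁆ = (0, 0, s • w' - s' • w)`. -/
def TwoStepLie (K W : Type*) : Type _ := K × W × W

namespace TwoStepLie

variable {K W : Type*} [Field K] [AddCommGroup W] [Module K W]

instance : AddCommGroup (TwoStepLie K W) := inferInstanceAs (AddCommGroup (K × W × W))

instance : Module K (TwoStepLie K W) := inferInstanceAs (Module K (K × W × W))

instance : LieRing (TwoStepLie K W) where
  bracket x y := (0, 0, x.1 • y.2.1 - y.1 • x.2.1)
  add_lie x y z := by
    refine Prod.ext (add_zero (0 : K)).symm (Prod.ext (add_zero (0 : W)).symm ?_)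
    change (x.1 + y.1) • z.2.1 - z.1 • (x.2.1 + y.2.1)
      = (x.1 • z.2.1 - z.1 • x.2.1) + (y.1 • z.2.1 - z.1 • y.2.1)
    module
  lie_add x y z := by
    refine Prod.ext (add_zero (0 : K)).symm (Prod.ext (add_zero (0 : W)).symm ?_)
    change x.1 • (y.2.1 + z.2.1) - (y.1 + z.1) • x.2.1
      = (x.1 • y.2.1 - y.1 • x.2.1) + (x.1 • z.2.1 - z.1 • x.2.1)
    module
  lie_self x := Prod.ext rfl (Prod.ext rfl (sub_self _))
  leibniz_lie x y z := by
    refine Prod.ext (add_zero (0 : K)).symm (Prod.ext (add_zero (0 : W)).symm ?_)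
    change x.1 • (0 : W) - (0 : K) • x.2.1
      = ((0 : K) • z.2.1 - z.1 • (0 : W)) + (y.1 • (0 : W) - (0 : K) • y.2.1)
    module

instance : LieAlgebra K (TwoStepLie K W) where
  lie_smul t x y := by
    refine Prod.ext (smul_zero t).symm (Prod.ext (smul_zero t).symm ?_)
    change x.1 • (t • y.2.1) - (t * y.1) • x.2.1 = t • (x.1 • y.2.1 - y.1 • x.2.1)
    module

theorem lie_lie_eq_zero (x y z : TwoStepLie K W) : ⁅x, ⁅y, z⁆⁆ = 0 := by
  refine Prod.ext rfl (Prod.ext rfl ?_)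
  change x.1 • (0 : W) - (0 : K) • x.2.1 = 0
  module

variable (K W) in
theorem lowerCentralSeries_three_eq_bot :
    LieModule.lowerCentralSeries K (TwoStepLie K W) (TwoStepLie K W) 3 = ⊥ := by
  have h : LieModule.lowerCentralSeries K (TwoStepLie K W) (TwoStepLie K W) 2 = ⊥ := by
    rw [LieModule.lowerCentralSeries_succ, LieSubmodule.lie_eq_bot_iff]
    intro x _ m hm
    rw [LieModule.lowerCentralSeries_succ, ← LieSubmodule.mem_toSubmodule,
      LieSubmodule.lieIdeal_oper_eq_linear_span'] at hm
    induction hm using Submodule.span_induction with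
    | mem m hm =>
      obtain ⟨y, _, z, _, rfl⟩ := hm
      exact lie_lie_eq_zero x y z
    | zero => exact lie_zero x
    | add a b _ _ ha hb => rw [lie_add, ha, hb, add_zero]
    | smul t a _ ha => rw [lie_smul, ha, smul_zero]
  rw [LieModule.lowerCentralSeries_succ, h, LieSubmodule.lie_bot]

variable (W) in
/-- The linear inclusion `w ↦ (φ w, w, 0)` attached to a linear functional `φ`. -/
def incl (φ : W →ₗ[K] K) : W →ₗ[K] TwoStepLie K W :=
  φ.prod (LinearMap.id.prod 0)

theorem lie_incl (φ : W →ₗ[K] K) (a b : W) :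
    ⁅incl W φ a, incl W φ b⁆ = ((0, 0, φ a • b - φ b • a) : K × W × W) :=
  rfl

end TwoStepLie

/-- If `T : V → L` is linear and any relation `⁅T a, T c⁆ = ⁅T b, T d⁆` lifts to the contractions
of `a ∧ c = b ∧ d` with linear functionals, then for `b` outside the line of `a` the images
of `ad (T a)` and `ad (T b)` on `range T` meet exactly in the line of `⁅T a, T b⁆`. -/
theorem map_ad_range_inf_map_ad_range {K V L : Type*} [Field K] [AddCommGroup V] [Module K V]
    [LieRing L] [LieAlgebra K L] (T : V →ₗ[K] L)
    (hT : ∀ (φ : V →ₗ[K] K) {a b c d : V}, ⁅T a, T c⁆ = ⁅T b, T d⁆ →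
      φ a • c - φ c • a = φ b • d - φ d • b)
    {a b : V} (hb : b ∉ Submodule.span K {a}) :
    Submodule.map (LieAlgebra.ad K L (T a) : L →ₗ[K] L) (LinearMap.range T) ⊓
      Submodule.map (LieAlgebra.ad K L (T b) : L →ₗ[K] L) (LinearMap.range T) =
      Submodule.span K {⁅T a, T b⁆} := by
  apply le_antisymm
  · rintro _ ⟨⟨_, ⟨c, rfl⟩, rfl⟩, ⟨_, ⟨d, rfl⟩, hd⟩⟩
    simp only [LieAlgebra.ad_apply] at hd ⊢
    obtain ⟨φ, hφb, hφ⟩ := Submodule.exists_le_ker_of_notMem hb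
    have hφa : φ a = 0 := hφ (Submodule.mem_span_singleton_self a)
    have key := hT φ hd
    rw [hφa, zero_smul, zero_sub, sub_eq_iff_eq_add, neg_add_eq_sub] at key
    rw [← hd, (eq_inv_smul_iff₀ hφb).2 key, Submodule.mem_span_singleton]
    refine ⟨(φ b)⁻¹ * φ c, ?_⟩
    simp only [map_smul, map_sub, lie_smul, lie_sub, lie_self, ← lie_skew (T b) (T a)]
    module
  · rw [Submodule.span_singleton_le_iff_mem]
    exact ⟨⟨T b, ⟨b, rfl⟩, rfl⟩, ⟨-T a, ⟨-a, map_neg T a⟩, by simp⟩⟩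

namespace FreeNilpotentLie

theorem lift_linearCombination_of {K : Type*} [Field K] {r : ℕ}
    {L : Type*} [LieRing L] [LieAlgebra K L] (g : (Fin r → K) →ₗ[K] L) (a : Fin r → K) :
    FreeLieAlgebra.lift K (fun i => g (Pi.single i 1))
      (Fintype.linearCombination K (FreeLieAlgebra.of K) a) = g a := by
  conv_rhs => rw [pi_eq_sum_univ' a]
  simp only [Fintype.linearCombination_apply, map_sum, map_smul, FreeLieAlgebra.lift_of_apply]

theorem mk_linearCombination_of {K : Type*} [Field K] {r s : ℕ} (a : Fin r → K) :
    (LieSubmodule.Quotient.mk (Fintype.linearCombination K (FreeLieAlgebra.of K) a) :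
      FreeNilpotentLie K r s) = Fintype.linearCombination K (gen K r s) a := by
  change LieSubmodule.Quotient.mk' _ _ = _
  simp [Fintype.linearCombination_apply, gen]

theorem G1_eq_range (K : Type*) [Field K] (r s : ℕ) :
    G1 K r s = LinearMap.range (Fintype.linearCombination K (gen K r s)) :=
  (Fintype.range_linearCombination K (gen K r s)).symm

/-- An equality of brackets of elements of `G₁` gives, for every linear functional `φ`,
an equality of the contractions with `φ` of the corresponding bivectors. -/
theorem contraction_eq_of_lie_eq {K : Type*} [Field K] {r : ℕ} (φ : (Fin r → K) →ₗ[K] K)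
    {a b c d : Fin r → K}
    (h : ⁅Fintype.linearCombination K (gen K r 3) a, Fintype.linearCombination K (gen K r 3) c⁆ =
      ⁅Fintype.linearCombination K (gen K r 3) b, Fintype.linearCombination K (gen K r 3) d⁆) :
    φ a • c - φ c • a = φ b • d - φ d • b := by
  let f := FreeLieAlgebra.lift K (fun i => TwoStepLie.incl _ φ (Pi.single i 1))
  simp only [← mk_linearCombination_of, ← LieSubmodule.Quotient.mk_bracket] at h
  have hmem := (Submodule.Quotient.eq _).1 h
  have hmap := LieIdeal.map_lowerCentralSeries_le 3 (f := f) (LieIdeal.mem_map hmem)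
  rw [TwoStepLie.lowerCentralSeries_three_eq_bot, LieSubmodule.mem_bot, map_sub, sub_eq_zero,
    LieHom.map_lie, LieHom.map_lie] at hmap
  simp only [f, lift_linearCombination_of, TwoStepLie.lie_incl] at hmap
  exact congrArg (fun x : K × _ × _ => x.2.2) hmap

end FreeNilpotentLie

/-- Let `L` be the free nilpotent Lie algebra of rank `r ≥ 2` and step 3
over a field of characteristic zero, `G₁` the span of the generators.  If `u, v ∈ G₁` are
linearly independent, then `span{⁅u, x⁆ : x ∈ G₁} ∩ span{⁅v, x⁆ : x ∈ G₁}` is exactly the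
line spanned by `⁅u, v⁆`. -/
theorem inf_of_bracket_images_eq_span_bracket
    (K : Type*) [Field K] [CharZero K] (r : ℕ) (hr : 2 ≤ r)
    (u v : FreeNilpotentLie K r 3)
    (hu : u ∈ FreeNilpotentLie.G1 K r 3) (hv : v ∈ FreeNilpotentLie.G1 K r 3)
    (huv : LinearIndependent K ![u, v]) :
    Submodule.map (LieAlgebra.ad K (FreeNilpotentLie K r 3) u : (FreeNilpotentLie K r 3) →ₗ[K] (FreeNilpotentLie K r 3)) (FreeNilpotentLie.G1 K r 3) ⊓
      Submodule.map (LieAlgebra.ad K (FreeNilpotentLie K r 3) v : (FreeNilpotentLie K r 3) →ₗ[K] (FreeNilpotentLie K r 3)) (FreeNilpotentLie.G1 K r 3) =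
      Submodule.span K {⁅u, v⁆} := by
  rw [FreeNilpotentLie.G1_eq_range] at hu hv ⊢
  obtain ⟨a, rfl⟩ := hu
  obtain ⟨b, rfl⟩ := hv
  refine map_ad_range_inf_map_ad_range _
    (fun φ _ _ _ _ => FreeNilpotentLie.contraction_eq_of_lie_eq φ) fun hb => ?_
  obtain ⟨t, rfl⟩ := Submodule.mem_span_singleton.1 hb
  simpa using LinearIndependent.pair_iff.1 huv t (-1) (by simp)
end
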